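/- Let g be a finite-dimensional Lie algebra over a field F whose center Z(g) is one-dimensional, spanned by z, and assume [g,g] ⊆ Z(g) (g is two-step nilpotent). Then every abelian Lie subalgebra a of g with z ∉ a satisfies 2·dim a ≤ dim g − 1. -/

import Mathlib

/-- Let `g` be a finite-dimensional Lie algebra over a field `F` whose center `Z(g)` is
one-dimensional, spanned by `z`, and assume `[g,g] ⊆ Z(g)` (so `g` is two-step
nilpotent).  Then every abelian Lie subalgebra `a` of `g` with `z ∉ a` satisfies
`2 · dim a ≤ dim g − 1`. -/
theorem stmt_1 (F : Type*) [Field F]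
    (g : Type*) [LieRing g] [LieAlgebra F g] [FiniteDimensional F g]
    (z : g) (hz : z ≠ 0)
    (hcenter : (LieAlgebra.center F g : Submodule F g) = Submodule.span F {z})
    (hderived : ∀ x y : g, ⁅x, y⁆ ∈ LieAlgebra.center F g)
    (a : LieSubalgebra F g)
    (habelian : ∀ x ∈ a, ∀ y ∈ a, ⁅x, y⁆ = 0)
    (hza : z ∉ a) :
    2 * Module.finrank F a ≤ Module.finrank F g - 1 := by
  obtain ⟨φ, hφ⟩ : ∃ φ : Module.Dual F g, φ z ≠ 0 := by
    by_contra! h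
    exact hz ((Module.forall_dual_apply_eq_zero_iff F z).mp h)
  have mem_center (x : g) : x ∈ LieAlgebra.center F g ↔ ∃ c : F, c • z = x := by
    rw [← Submodule.mem_span_singleton, ← hcenter]
    rfl
  have eq_zero_of_apply {x : g} (hx : x ∈ LieAlgebra.center F g) (h : φ x = 0) : x = 0 := by
    obtain ⟨c, rfl⟩ := (mem_center x).mp hx
    have hc : c = 0 := by simpa [hφ] using h
    rw [hc, zero_smul]
  have eq_zero_of_mem {x : g} (hx : x ∈ LieAlgebra.center F g) (hxa : x ∈ a) : x = 0 := by
    obtain ⟨c, rfl⟩ := (mem_center x).mp hx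
    by_contra h
    exact hza ((a.toSubmodule.smul_mem_iff (left_ne_zero_of_smul h)).mp hxa)
  have center_comm {x : g} (hx : x ∈ LieAlgebra.center F g) (y : g) : ⁅y, x⁆ = 0 :=
    (LieModule.mem_maxTrivSubmodule F g g x).mp hx y
  let W : Submodule F g := a.toSubmodule ⊔ Submodule.span F {z}
  -- The pairing `x ↦ φ ⁅x, ·⁆` embeds `a` into the annihilator of `a + F z`.
  let f : a.toSubmodule →ₗ[F] Module.Dual F g :=
    (LinearMap.compRight F φ ∘ₗ (LieAlgebra.ad F g : g →ₗ[F] Module.End F g)) ∘ₗ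
      a.toSubmodule.subtype
  have f_apply (x : a.toSubmodule) (y : g) : f x y = φ ⁅(x : g), y⁆ := rfl
  have f_mem (x : a.toSubmodule) : f x ∈ W.dualAnnihilator := by
    rw [Submodule.dualAnnihilator_sup_eq, Submodule.mem_inf]
    constructor <;> rw [Submodule.mem_dualAnnihilator] <;> intro y hy <;> rw [f_apply]
    · rw [habelian x x.2 y hy, map_zero]
    · rw [← hcenter] at hy
      rw [center_comm hy, map_zero]
  have f_inj : Function.Injective (f.codRestrict W.dualAnnihilator f_mem) := by
    refine (injective_iff_map_eq_zero _).mpr fun x hfx => ?_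
    have hx : f x = 0 := congrArg Subtype.val hfx
    refine Subtype.ext (eq_zero_of_mem ?_ x.2)
    refine (LieModule.mem_maxTrivSubmodule F g g (x : g)).mpr fun y => ?_
    rw [← lie_skew, neg_eq_zero]
    exact eq_zero_of_apply (hderived _ _) (by rw [← f_apply, hx, LinearMap.zero_apply])
  have hle := LinearMap.finrank_le_finrank_of_injective f_inj
  have hW := Subspace.finrank_add_finrank_dualAnnihilator_eq W
  have hdim : Module.finrank F W = Module.finrank F a.toSubmodule + 1 :=
    Submodule.finrank_sup_span_singleton hza
  change 2 * Module.finrank F a.toSubmodule ≤ _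
  omega
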